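/- arXiv:2204.12436 — 7 statements merged into one kernel-verified Lean document; each statement's English description precedes it below -/
import Mathlib

section
/- Let m ≥ 4 and let N be a finite electorate with |N| ≥ 5 odd. Every social decision scheme on N that is Condorcet-consistent is PC-manipulable; that is, there exist a voter i ∈ N and preference profiles R, R' on N agreeing on every voter except i such that f(R') ≻_i^PC f(R) with respect to voter i's preference relation in R. -/
open scoped Classical
open Finset

noncomputable section

/-- A strict preference relation: a strict linear (total) order on `A`. -/
abbrev Pref (A : Type*) : Type _ := {r : A → A → Prop // IsStrictTotalOrder A r}

/-- A lottery over the finite set `A` of alternatives. -/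
def Lottery (A : Type*) [Fintype A] : Type _ :=
  {p : A → ℝ // (∀ x, 0 ≤ p x) ∧ ∑ x : A, p x = 1}

variable {A : Type*} [Fintype A]

/-- `∑_{x ≻ y} p(x) q(y)`. -/
def PCsum (r : Pref A) (p q : A → ℝ) : ℝ :=
  ∑ x : A, ∑ y : A, if r.val x y then p x * q y else 0

/-- Pairwise-comparison (weak) preference over lotteries: `p ≿^PC q`. -/
def PCge (r : Pref A) (p q : Lottery A) : Prop :=
  PCsum r q.val p.val ≤ PCsum r p.val q.val

/-- Pairwise-comparison strict preference over lotteries: `p ≻^PC q`. -/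
def PCgt (r : Pref A) (p q : Lottery A) : Prop :=
  PCsum r q.val p.val < PCsum r p.val q.val

/-- An SDS on a fixed electorate `N` is PC-strategyproof if every voter always
weakly PC-prefers the truthful outcome to any outcome from a unilateral deviation. -/
def PCStrategyproof {N : Type*} (f : (N → Pref A) → Lottery A) : Prop :=
  ∀ (i : N) (R R' : N → Pref A), (∀ j, j ≠ i → R j = R' j) → PCge (R i) (f R) (f R')

/-- Majority margin `g_R(x,y)`. -/
def margin {I : Type*} [Fintype I] (R : I → Pref A) (x y : A) : ℤ :=
  ((univ.filter fun i => (R i).val x y).card : ℤ) -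
    ((univ.filter fun i => (R i).val y x).card : ℤ)

/-- `x` is a Condorcet winner of `R`. -/
def CondorcetWinner {I : Type*} [Fintype I] (R : I → Pref A) (x : A) : Prop :=
  ∀ y, y ≠ x → 0 < margin R x y

/-- Condorcet-consistency on a fixed electorate. -/
def CondorcetConsistent {N : Type*} [Fintype N] (f : (N → Pref A) → Lottery A) : Prop :=
  ∀ (R : N → Pref A) (x : A), CondorcetWinner R x → (f R).val x = 1

/-- The preference relation that ranks alternatives by increasing value of an injective key. -/
def Pref.ofKey {A : Type*} (key : A → ℕ) (hkey : Function.Injective key) : Pref A :=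
  ⟨fun x y => key x < key y,
    { trichotomous := fun _ _ hxy hyx => hkey (by omega)
      irrefl := fun _ => lt_irrefl _
      trans := fun _ _ _ => lt_trans }⟩

/-- The reversed preference relation. -/
def Pref.reverse {A : Type*} (r : Pref A) : Pref A :=
  ⟨fun x y => r.val y x,
    { trichotomous := fun _ _ hxy hyx => r.property.trichotomous _ _ hyx hxy
      irrefl := fun _ => r.property.irrefl _
      trans := fun _ _ _ hxy hyz => r.property.trans _ _ _ hyz hxy }⟩

/-- With alternatives identified with `Fin 4 ⊕ Fin l`, rank the four core alternatives according to
`σ` (mapping an alternative to its rank), followed by the remaining ones in their natural order. -/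
def corePref {A : Type*} {l : ℕ} (a : A ≃ Fin 4 ⊕ Fin l) (σ : Equiv.Perm (Fin 4)) : Pref A :=
  Pref.ofKey (fun z =>
      Sum.elim (fun i : Fin 4 => (σ i : ℕ)) (fun j : Fin l => 4 + (j : ℕ)) (a z)) <| by
    refine Function.Injective.comp (g := Sum.elim _ _) ?_ a.injective
    refine Function.Injective.sumElim (fun i j h => σ.injective (Fin.ext h))
      (fun i j h => Fin.ext (by simpa using h)) fun i j => ?_
    have := (σ i).isLt
    omega

/-- With voters identified with `Fin 5 ⊕ Fin k × Bool`, the five core voters rank the core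
alternatives according to `S`, and the remaining voters come in pairs with opposite preferences. -/
def coreProfile {A N : Type*} {l k : ℕ} (a : A ≃ Fin 4 ⊕ Fin l) (e : N ≃ Fin 5 ⊕ Fin k × Bool)
    (S : Fin 5 → Equiv.Perm (Fin 4)) : N → Pref A := fun v =>
  Sum.elim (fun i => corePref a (S i))
    (fun b => if b.2 then corePref a 1 else (corePref a 1).reverse) (e v)

/-- `x` is the Condorcet winner among the core alternatives for the core voters. -/
def CoreWinner (S : Fin 5 → Equiv.Perm (Fin 4)) (x : Fin 4) : Prop :=
  ∀ y, y ≠ x → 0 < ∑ i, ((if S i x < S i y then 1 else 0) - (if S i y < S i x then 1 else 0) : ℤ)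

instance (S : Fin 5 → Equiv.Perm (Fin 4)) (x : Fin 4) : Decidable (CoreWinner S x) :=
  inferInstanceAs (Decidable (∀ y, y ≠ x → _))

/-- `PCsum` restricted to the core alternatives. -/
def coreSum (σ : Equiv.Perm (Fin 4)) (p q : Fin 4 → ℝ) : ℝ :=
  ∑ i, ∑ j, if σ i < σ j then p i * q j else 0

section

variable {l k : ℕ} (a : A ≃ Fin 4 ⊕ Fin l)

/-- The probabilities of the core alternatives. -/
def Lottery.core (p : Lottery A) (i : Fin 4) : ℝ := p.val (a.symm (Sum.inl i))

/-- The total probability of the alternatives outside the core. -/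
def Lottery.rest (p : Lottery A) : ℝ := ∑ j, p.val (a.symm (Sum.inr j))

lemma Lottery.core_nonneg (p : Lottery A) (i : Fin 4) : 0 ≤ p.core a i := p.property.1 _

lemma Lottery.rest_nonneg (p : Lottery A) : 0 ≤ p.rest a :=
  Finset.sum_nonneg fun _ _ => p.property.1 _

lemma Lottery.sum_core_add_rest (p : Lottery A) : ∑ i, p.core a i + p.rest a = 1 := by
  rw [← p.property.2, ← a.symm.sum_comp, Fintype.sum_sum_type]
  rfl

lemma Lottery.rest_eq_zero_iff (p : Lottery A) :
    p.rest a = 0 ↔ ∀ j, p.val (a.symm (Sum.inr j)) = 0 := by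
  simp [Lottery.rest, Finset.sum_eq_zero_iff_of_nonneg fun _ _ => p.property.1 _]

lemma Lottery.eq_single_of_core_eq_one (p : Lottery A) (x : Fin 4) (hx : p.core a x = 1) :
    p.core a = Pi.single x 1 ∧ p.rest a = 0 := by
  have hsum := p.sum_core_add_rest a
  have hrest := p.rest_nonneg a
  have h0 := p.core_nonneg a 0
  have h1 := p.core_nonneg a 1
  have h2 := p.core_nonneg a 2
  have h3 := p.core_nonneg a 3
  rw [Fin.sum_univ_four] at hsum
  refine ⟨funext fun i => ?_, ?_⟩
  · fin_cases x <;> fin_cases i <;> simp at hx ⊢ <;> linarith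
  · fin_cases x <;> simp at hx <;> linarith

lemma PCsum_corePref_right (σ : Equiv.Perm (Fin 4)) (p q : Lottery A) (hq : q.rest a = 0) :
    PCsum (corePref a σ) p.val q.val = coreSum σ (p.core a) (q.core a) := by
  rw [Lottery.rest_eq_zero_iff] at hq
  have hlt (j : Fin l) (i : Fin 4) : ¬ 4 + (j : ℕ) < σ i := by have := (σ i).isLt; omega
  simp only [PCsum, coreSum, ← a.symm.sum_comp, Fintype.sum_sum_type]
  simp [hq, corePref, Pref.ofKey, Lottery.core, hlt]

lemma PCsum_corePref_left (σ : Equiv.Perm (Fin 4)) (p q : Lottery A) (hq : q.rest a = 0) :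
    PCsum (corePref a σ) q.val p.val = coreSum σ (q.core a) (p.core a) + p.rest a := by
  have hsum := q.sum_core_add_rest a
  rw [hq, add_zero] at hsum
  rw [Lottery.rest_eq_zero_iff] at hq
  have hlt (j : Fin l) (i : Fin 4) : (σ i : ℕ) < 4 + (j : ℕ) := by have := (σ i).isLt; omega
  simp only [PCsum, coreSum, ← a.symm.sum_comp, Fintype.sum_sum_type]
  simp only [hq, corePref, Pref.ofKey, Equiv.apply_symm_apply, Sum.elim_inl, Sum.elim_inr, hlt,
    if_true, Finset.sum_add_distrib, zero_mul, ite_self, Finset.sum_const_zero, add_zero,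
    ← Finset.mul_sum, ← Finset.sum_mul, Fin.val_fin_lt]
  change _ + (∑ i, q.core a i) * p.rest a = _ + p.rest a
  rw [hsum, one_mul]
  rfl

lemma margin_eq_sum {A I : Type*} [Fintype I] (R : I → Pref A) (x y : A) :
    margin R x y = ∑ i, ((if (R i).val x y then 1 else 0) - (if (R i).val y x then 1 else 0)) := by
  simp [margin, Finset.sum_sub_distrib]

variable {N : Type*} (e : N ≃ Fin 5 ⊕ Fin k × Bool)

lemma margin_coreProfile {A N : Type*} [Fintype N] (a : A ≃ Fin 4 ⊕ Fin l)
    (e : N ≃ Fin 5 ⊕ Fin k × Bool) (S : Fin 5 → Equiv.Perm (Fin 4)) (x y : A) :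
    margin (coreProfile a e S) x y = margin (fun i => corePref a (S i)) x y := by
  simp only [margin_eq_sum, ← e.symm.sum_comp, Fintype.sum_sum_type, Fintype.sum_prod_type]
  simp only [coreProfile, Equiv.apply_symm_apply, Sum.elim_inl, Sum.elim_inr, Fintype.sum_bool,
    Pref.reverse]
  simp

lemma condorcetWinner_coreProfile {A N : Type*} [Fintype N] (a : A ≃ Fin 4 ⊕ Fin l)
    (e : N ≃ Fin 5 ⊕ Fin k × Bool) {S : Fin 5 → Equiv.Perm (Fin 4)} {x : Fin 4} (hx : CoreWinner S x) :
    CondorcetWinner (coreProfile a e S) (a.symm (Sum.inl x)) := by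
  intro y hy
  rw [margin_coreProfile, margin_eq_sum]
  obtain ⟨y | y, rfl⟩ := a.symm.surjective y
  · simpa [corePref, Pref.ofKey] using hx y (by rintro rfl; exact hy rfl)
  · have hlt (i : Fin 5) : (S i x : ℕ) < 4 + (y : ℕ) := by have := (S i x).isLt; omega
    simp [corePref, Pref.ofKey, hlt, (hlt _).not_gt]

lemma coreProfile_update_ne {A N : Type*} (a : A ≃ Fin 4 ⊕ Fin l) (e : N ≃ Fin 5 ⊕ Fin k × Bool)
    (S : Fin 5 → Equiv.Perm (Fin 4)) (i : Fin 5) (τ : Equiv.Perm (Fin 4)) (v : N)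
    (hv : v ≠ e.symm (Sum.inl i)) :
    coreProfile a e S v = coreProfile a e (Function.update S i τ) v := by
  obtain ⟨j | b, rfl⟩ := e.symm.surjective v
  · have hj : j ≠ i := by rintro rfl; exact hv rfl
    simp [coreProfile, hj]
  · simp [coreProfile]

/-- A voter truthfully reporting `S i` does not gain by deviating to a profile whose outcome is
supported on the core. -/
lemma PCStrategyproof.core_truthful {f : (N → Pref A) → Lottery A} (hf : PCStrategyproof f)
    (S : Fin 5 → Equiv.Perm (Fin 4)) (i : Fin 5) (τ : Equiv.Perm (Fin 4)) {p q : Lottery A}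
    (hp : f (coreProfile a e S) = p) (hq : f (coreProfile a e (Function.update S i τ)) = q)
    (h : q.rest a = 0) :
    coreSum (S i) (q.core a) (p.core a) + p.rest a ≤ coreSum (S i) (p.core a) (q.core a) := by
  have := hf (e.symm (Sum.inl i)) _ _ (coreProfile_update_ne a e S i τ)
  rw [hp, hq] at this
  simpa [PCge, coreProfile, PCsum_corePref_left, PCsum_corePref_right, h] using this

/-- A voter with true preference `τ`, in a profile whose outcome is supported on the core, does not
gain by reporting `S i` instead. -/
lemma PCStrategyproof.core_deviation {f : (N → Pref A) → Lottery A} (hf : PCStrategyproof f)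
    (S : Fin 5 → Equiv.Perm (Fin 4)) (i : Fin 5) (τ : Equiv.Perm (Fin 4)) {p q : Lottery A}
    (hp : f (coreProfile a e S) = p) (hq : f (coreProfile a e (Function.update S i τ)) = q)
    (h : q.rest a = 0) :
    coreSum τ (p.core a) (q.core a) ≤ coreSum τ (q.core a) (p.core a) + p.rest a := by
  have := hf (e.symm (Sum.inl i)) _ _ fun v hv => (coreProfile_update_ne a e S i τ v hv).symm
  rw [hp, hq] at this
  simpa [PCge, coreProfile, PCsum_corePref_left, PCsum_corePref_right, h] using this

lemma CondorcetConsistent.core_eq_single [Fintype N] {f : (N → Pref A) → Lottery A}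
    (hf : CondorcetConsistent f) {S : Fin 5 → Equiv.Perm (Fin 4)} {x : Fin 4}
    (hx : CoreWinner S x) :
    (f (coreProfile a e S)).core a = Pi.single x 1 ∧ (f (coreProfile a e S)).rest a = 0 :=
  Lottery.eq_single_of_core_eq_one a _ x (hf _ _ (condorcetWinner_coreProfile a e hx))

end

/-- The ranking `0 ≻ 1 ≻ 2 ≻ 3`. -/
def rank0123 : Equiv.Perm (Fin 4) := 1

/-- The ranking `0 ≻ 2 ≻ 1 ≻ 3`. -/
def rank0213 : Equiv.Perm (Fin 4) := ⟨![0, 2, 1, 3], ![0, 2, 1, 3], by decide, by decide⟩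

/-- The ranking `0 ≻ 3 ≻ 1 ≻ 2`. -/
def rank0312 : Equiv.Perm (Fin 4) := ⟨![0, 2, 3, 1], ![0, 3, 1, 2], by decide, by decide⟩

/-- The ranking `1 ≻ 0 ≻ 2 ≻ 3`. -/
def rank1023 : Equiv.Perm (Fin 4) := ⟨![1, 0, 2, 3], ![1, 0, 2, 3], by decide, by decide⟩

/-- The ranking `1 ≻ 2 ≻ 3 ≻ 0`. -/
def rank1230 : Equiv.Perm (Fin 4) := ⟨![3, 0, 1, 2], ![1, 2, 3, 0], by decide, by decide⟩

/-- The ranking `2 ≻ 3 ≻ 1 ≻ 0`. -/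
def rank2310 : Equiv.Perm (Fin 4) := ⟨![3, 2, 0, 1], ![2, 3, 1, 0], by decide, by decide⟩

/-- The ranking `3 ≻ 0 ≻ 1 ≻ 2`. -/
def rank3012 : Equiv.Perm (Fin 4) := ⟨![1, 2, 3, 0], ![3, 0, 1, 2], by decide, by decide⟩

/-- The ranking `3 ≻ 2 ≻ 0 ≻ 1`. -/
def rank3201 : Equiv.Perm (Fin 4) := ⟨![2, 3, 1, 0], ![3, 2, 0, 1], by decide, by decide⟩

/-- A profile in which strategyproofness forces the uniform lottery on `{0, 2, 3}`. -/
def uniformProfile : Fin 5 → Equiv.Perm (Fin 4) :=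
  ![rank0312, rank0213, rank1230, rank2310, rank3012]

/-- The profile, one deviation away from `uniformProfile`, for which no outcome is possible. -/
def conflictProfile : Fin 5 → Equiv.Perm (Fin 4) :=
  ![rank0123, rank0213, rank1230, rank2310, rank3012]

lemma update_conflictProfile : Function.update conflictProfile 0 rank0312 = uniformProfile := by
  decide

section

variable {l k : ℕ} (a : A ≃ Fin 4 ⊕ Fin l) {N : Type*} [Fintype N] (e : N ≃ Fin 5 ⊕ Fin k × Bool)
  {f : (N → Pref A) → Lottery A}

lemma core_uniformProfile (hsp : PCStrategyproof f) (hf : CondorcetConsistent f) :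
    (f (coreProfile a e uniformProfile)).core a = ![1 / 3, 0, 1 / 3, 1 / 3] ∧
      (f (coreProfile a e uniformProfile)).rest a = 0 := by
  obtain ⟨c₁, r₁⟩ := hf.core_eq_single a e
    (S := Function.update uniformProfile 0 rank3201) (x := 2) (by decide)
  obtain ⟨c₂, r₂⟩ := hf.core_eq_single a e
    (S := Function.update uniformProfile 3 rank3012) (x := 3) (by decide)
  obtain ⟨c₃, r₃⟩ := hf.core_eq_single a e
    (S := Function.update uniformProfile 4 rank0123) (x := 0) (by decide)
  have i₁ := hsp.core_deviation a e uniformProfile 0 rank3201 rfl rfl r₁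
  have i₂ := hsp.core_truthful a e uniformProfile 3 rank3012 rfl rfl r₂
  have i₃ := hsp.core_truthful a e uniformProfile 4 rank0123 rfl rfl r₃
  rw [c₁] at i₁
  rw [c₂] at i₂
  rw [c₃] at i₃
  generalize f (coreProfile a e uniformProfile) = p at *
  have h0 := p.core_nonneg a 0
  have h1 := p.core_nonneg a 1
  have h2 := p.core_nonneg a 2
  have h3 := p.core_nonneg a 3
  have hr := p.rest_nonneg a
  have hs := p.sum_core_add_rest a
  simp [coreSum, Fin.sum_univ_four, uniformProfile, rank3201, rank2310, rank3012] at i₁ i₂ i₃ hs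
  refine ⟨funext fun i => ?_, by linarith⟩
  fin_cases i <;> simp <;> linarith

lemma not_pcStrategyproof_of_condorcetConsistent (a : A ≃ Fin 4 ⊕ Fin l)
    (e : N ≃ Fin 5 ⊕ Fin k × Bool) (hf : CondorcetConsistent f) :
    ¬ PCStrategyproof f := by
  intro hsp
  obtain ⟨c₁, r₁⟩ := hf.core_eq_single a e
    (S := Function.update conflictProfile 0 rank1023) (x := 1) (by decide)
  obtain ⟨c₂, r₂⟩ := hf.core_eq_single a e
    (S := Function.update conflictProfile 4 rank0123) (x := 0) (by decide)
  obtain ⟨c₃, r₃⟩ := core_uniformProfile a e hsp hf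
  rw [← update_conflictProfile] at c₃ r₃
  have i₁ := hsp.core_truthful a e conflictProfile 0 rank1023 rfl rfl r₁
  have i₂ := hsp.core_truthful a e conflictProfile 4 rank0123 rfl rfl r₂
  have i₃ := hsp.core_deviation a e conflictProfile 0 rank0312 rfl rfl r₃
  rw [c₁] at i₁
  rw [c₂] at i₂
  rw [c₃] at i₃
  generalize f (coreProfile a e conflictProfile) = p at *
  have h0 := p.core_nonneg a 0
  have h1 := p.core_nonneg a 1
  have h2 := p.core_nonneg a 2
  have h3 := p.core_nonneg a 3
  have hr := p.rest_nonneg a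
  have hs := p.sum_core_add_rest a
  simp [coreSum, Fin.sum_univ_four, conflictProfile, rank0123, rank0312, rank3012] at i₁ i₂ i₃ hs
  linarith

end

/-- For `m ≥ 4` alternatives and a finite electorate of odd size at least 5,
every Condorcet-consistent SDS is PC-manipulable: some voter can unilaterally deviate to a
profile whose outcome he strictly PC-prefers. -/
theorem condorcet_consistent_implies_pc_manipulable
    {A N : Type*} [Fintype A] [Fintype N]
    (hm : 4 ≤ Fintype.card A) (hn : 5 ≤ Fintype.card N) (hodd : Odd (Fintype.card N))
    (f : (N → Pref A) → Lottery A) (hf : CondorcetConsistent f) :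
    ∃ (i : N) (R R' : N → Pref A),
      (∀ j, j ≠ i → R j = R' j) ∧ PCgt (R i) (f R') (f R) := by
  by_contra! h
  obtain ⟨l, hl⟩ := Nat.exists_eq_add_of_le hm
  obtain ⟨k, hk⟩ : ∃ k, Fintype.card N = 5 + k * 2 := by
    obtain ⟨t, ht⟩ := hodd
    exact ⟨t - 2, by omega⟩
  have a : A ≃ Fin 4 ⊕ Fin l := Fintype.equivOfCardEq (by simpa using hl)
  have e : N ≃ Fin 5 ⊕ Fin k × Bool := Fintype.equivOfCardEq (by simpa using hk)
  exact not_pcStrategyproof_of_condorcetConsistent a e hf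
    fun i R R' hR => not_lt.mp (h i R R' hR)

end
end

section
/- Let f be a PC-strategyproof social decision scheme on a finite electorate N, let R, R' be preference profiles on N agreeing on every voter except i ∈ N, and let a, b ∈ A be distinct alternatives such that a ≻_i b if and only if a ≻'_i b (voter i ranks a and b in the same relative order in R and R'). If supp(f(R)) ⊆ {a,b} and supp(f(R')) ⊆ {a,b}, then f(R) = f(R'). -/
open scoped Classical
open Finset

noncomputable section

variable {A : Type*} [Fintype A]

namespace Lottery

theorem eq_zero_of_support_subset_pair {A : Type*} [Fintype A] {p : Lottery A} {a b x : A}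
    (hp : ∀ x, 0 < p.val x → x = a ∨ x = b) (hx : x ≠ a ∧ x ≠ b) : p.val x = 0 := by
  by_contra h
  have := hp x (lt_of_le_of_ne (p.2.1 x) (Ne.symm h))
  tauto

theorem add_eq_one_of_support_subset_pair {A : Type*} [Fintype A] {p : Lottery A} {a b : A}
    (hab : a ≠ b) (hp : ∀ x, 0 < p.val x → x = a ∨ x = b) : p.val a + p.val b = 1 := by
  rw [← Fintype.sum_eq_add a b hab fun _ hx => eq_zero_of_support_subset_pair hp hx]
  exact p.2.2

end Lottery

/-- If `a ≻ b` and both lotteries are supported on `{a, b}`, only the pair `(a, b)` contributes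
to `PCsum`. -/
theorem PCsum_eq_mul_of_support_subset_pair {A : Type*} [Fintype A] {r : Pref A}
    {p q : Lottery A} {a b : A} (hr : r.val a b)
    (hp : ∀ x, 0 < p.val x → x = a ∨ x = b) (hq : ∀ x, 0 < q.val x → x = a ∨ x = b) :
    PCsum r p.val q.val = p.val a * q.val b := by
  have := r.2
  have hba : ¬ r.val b a := fun h => irrefl_of r.val a (trans_of r.val hr h)
  have hab : a ≠ b := fun h => irrefl_of r.val b (h ▸ hr)
  have inner (x : A) : (∑ y : A, if r.val x y then p.val x * q.val y else 0) =
      (if r.val x a then p.val x * q.val a else 0) +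
        if r.val x b then p.val x * q.val b else 0 :=
    Fintype.sum_eq_add a b hab fun y hy => by
      simp [Lottery.eq_zero_of_support_subset_pair hq hy]
  unfold PCsum
  simp only [inner]
  rw [Fintype.sum_eq_add a b hab fun x hx => by
    simp [Lottery.eq_zero_of_support_subset_pair hp hx]]
  simp [hr, hba, irrefl_of r.val a, irrefl_of r.val b]

/-- On lotteries supported on `{a, b}` with `a ≻ b`, PC preference compares the probability
of `a`. -/
theorem PCge_iff_of_support_subset_pair {A : Type*} [Fintype A] {r : Pref A}
    {p q : Lottery A} {a b : A} (hr : r.val a b)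
    (hp : ∀ x, 0 < p.val x → x = a ∨ x = b) (hq : ∀ x, 0 < q.val x → x = a ∨ x = b) :
    PCge r p q ↔ q.val a ≤ p.val a := by
  have := r.2
  have hab : a ≠ b := fun h => irrefl_of r.val b (h ▸ hr)
  rw [PCge, PCsum_eq_mul_of_support_subset_pair hr hp hq,
    PCsum_eq_mul_of_support_subset_pair hr hq hp,
    eq_sub_of_add_eq' (Lottery.add_eq_one_of_support_subset_pair hab hp),
    eq_sub_of_add_eq' (Lottery.add_eq_one_of_support_subset_pair hab hq)]
  constructor <;> intro h <;> linarith

theorem Lottery.eq_of_PCge_of_PCge {A : Type*} [Fintype A] {r r' : Pref A}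
    {p q : Lottery A} {a b : A} (hr : r.val a b) (hr' : r'.val a b)
    (hp : ∀ x, 0 < p.val x → x = a ∨ x = b) (hq : ∀ x, 0 < q.val x → x = a ∨ x = b)
    (hpq : PCge r p q) (hqp : PCge r' q p) : p = q := by
  have := r.2
  have hab : a ≠ b := fun h => irrefl_of r.val b (h ▸ hr)
  have ha : p.val a = q.val a :=
    le_antisymm ((PCge_iff_of_support_subset_pair hr' hq hp).1 hqp)
      ((PCge_iff_of_support_subset_pair hr hp hq).1 hpq)
  have hb : p.val b = q.val b := by
    linarith [add_eq_one_of_support_subset_pair hab hp,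
      add_eq_one_of_support_subset_pair hab hq]
  refine Subtype.ext (funext fun x => ?_)
  by_cases hxa : x = a
  · rw [hxa, ha]
  by_cases hxb : x = b
  · rw [hxb, hb]
  rw [eq_zero_of_support_subset_pair hp ⟨hxa, hxb⟩, eq_zero_of_support_subset_pair hq ⟨hxa, hxb⟩]

/-- If `f` is PC-strategyproof, `R` and `R'` differ only in voter `i`'s
preferences, voter `i` ranks the distinct alternatives `a` and `b` in the same relative
order in `R` and `R'`, and both outcomes are supported on `{a,b}`, then the outcomes
coincide. -/
theorem support_two_alternatives_outcome_unchanged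
    {A N : Type*} [Fintype A] [Fintype N]
    (f : (N → Pref A) → Lottery A) (hsp : PCStrategyproof f)
    (i : N) (R R' : N → Pref A) (hagree : ∀ j, j ≠ i → R j = R' j)
    (a b : A) (hab : a ≠ b)
    (horder : (R i).val a b ↔ (R' i).val a b)
    (hsupp : ∀ x, 0 < (f R).val x → x = a ∨ x = b)
    (hsupp' : ∀ x, 0 < (f R').val x → x = a ∨ x = b) :
    f R = f R' := by
  have hge := hsp i R R' hagree
  have hge' := hsp i R' R fun j hj => (hagree j hj).symm
  by_cases h : (R i).val a b
  · exact Lottery.eq_of_PCge_of_PCge h (horder.1 h) hsupp hsupp' hge hge'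
  · have hba (r : Pref A) (hr : ¬ r.val a b) : r.val b a := by
      have := r.2
      rcases trichotomous_of r.val a b with h | h | h
      exacts [absurd h hr, absurd h hab, h]
    exact Lottery.eq_of_PCge_of_PCge (hba _ h) (hba _ (mt horder.2 h))
      (fun x hx => (hsupp x hx).symm) (fun x hx => (hsupp' x hx).symm) hge hge'

end
end

section
/- Let f be a PC-strategyproof social decision scheme on a finite electorate N, let R, R' be preference profiles on N agreeing on every voter except i ∈ N, and let a, b, c ∈ A be three distinct alternatives with a ≻_i b ≻_i c (in R). If f(R,a) < f(R,c), supp(f(R)) ⊆ {a,b,c}, and supp(f(R')) ⊆ {a,b,c}, then f(R',a) < f(R',c). -/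
open scoped Classical
open Finset

noncomputable section

variable {A : Type*} [Fintype A]

/-- The pairwise-comparison sum of two functions vanishing outside `{a, b, c}`,
where `a ≻ b ≻ c`. -/
theorem PCsum_eq_of_three {A : Type*} [Fintype A] (r : Pref A) (p q : A → ℝ) {a b c : A}
    (hab : r.val a b) (hbc : r.val b c)
    (hp : ∀ x, x ≠ a → x ≠ b → x ≠ c → p x = 0)
    (hq : ∀ x, x ≠ a → x ≠ b → x ≠ c → q x = 0) :
    PCsum r p q = p a * q b + p a * q c + p b * q c := by
  have : IsStrictTotalOrder A r.val := r.property
  have hac : r.val a c := _root_.trans hab hbc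
  have sum_three : ∀ g : A → ℝ, (∀ x, x ≠ a → x ≠ b → x ≠ c → g x = 0) →
      ∑ x, g x = g a + g b + g c := by
    intro g hg
    rw [← Finset.sum_subset (Finset.subset_univ {a, b, c}) (by
      intro x _ hx
      simp only [Finset.mem_insert, Finset.mem_singleton, not_or] at hx
      exact hg x hx.1 hx.2.1 hx.2.2),
      Finset.sum_insert (by simp [ne_of_irrefl hab, ne_of_irrefl hac]),
      Finset.sum_insert (by simp [ne_of_irrefl hbc]), Finset.sum_singleton, add_assoc]
  have inner : ∀ x, (∑ y, if r.val x y then p x * q y else 0) =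
      (if r.val x a then p x * q a else 0) + (if r.val x b then p x * q b else 0) +
        (if r.val x c then p x * q c else 0) := fun x =>
    sum_three _ fun y ha hb hc => by simp [hq y ha hb hc]
  unfold PCsum
  simp only [inner]
  rw [sum_three _ fun x ha hb hc => by simp [hp x ha hb hc]]
  simp [hab, hbc, hac, irrefl_of r.val, asymm_of r.val hab, asymm_of r.val hbc,
    asymm_of r.val hac]

/-- A lottery supported on `{a, b, c}` vanishes elsewhere. -/
theorem Lottery.eq_zero_of_support {A : Type*} [Fintype A] (p : Lottery A) {a b c : A}
    (h : ∀ x, 0 < p.val x → x = a ∨ x = b ∨ x = c) (x : A)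
    (ha : x ≠ a) (hb : x ≠ b) (hc : x ≠ c) : p.val x = 0 := by
  by_contra hx
  rcases h x (lt_of_le_of_ne (p.property.1 x) (Ne.symm hx)) with h | h | h <;> contradiction

/-- If `f` is PC-strategyproof, `R` and `R'` differ only in voter `i`'s
preferences, voter `i` has `a ≻ᵢ b ≻ᵢ c` in `R`, both outcomes are supported on `{a,b,c}`,
and `f(R,a) < f(R,c)`, then `f(R',a) < f(R',c)`. -/
theorem support_three_alternatives_order_preserved
    {A N : Type*} [Fintype A] [Fintype N]
    (f : (N → Pref A) → Lottery A) (hsp : PCStrategyproof f)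
    (i : N) (R R' : N → Pref A) (hagree : ∀ j, j ≠ i → R j = R' j)
    (a b c : A) (hab : a ≠ b) (hac : a ≠ c) (hbc : b ≠ c)
    (hiab : (R i).val a b) (hibc : (R i).val b c)
    (hlt : (f R).val a < (f R).val c)
    (hsupp : ∀ x, 0 < (f R).val x → x = a ∨ x = b ∨ x = c)
    (hsupp' : ∀ x, 0 < (f R').val x → x = a ∨ x = b ∨ x = c) :
    (f R').val a < (f R').val c := by
  have hp := (f R).eq_zero_of_support hsupp
  have hq := (f R').eq_zero_of_support hsupp'
  have hge := hsp i R R' hagree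
  unfold PCge at hge
  rw [PCsum_eq_of_three (R i) _ _ hiab hibc hp hq,
    PCsum_eq_of_three (R i) _ _ hiab hibc hq hp] at hge
  have hp0 := (f R).property.1
  have hq0 := (f R').property.1
  by_contra! hle
  have hqb := mul_nonneg (hq0 b) (sub_nonneg.2 hlt.le)
  have hpb := mul_nonneg (hp0 b) (sub_nonneg.2 hle)
  have hpa := mul_nonneg (hp0 a) (sub_nonneg.2 hle)
  have hqa := mul_nonneg (hq0 a) (sub_nonneg.2 hlt.le)
  have ha : (f R').val a = 0 := by
    refine (mul_eq_zero.1 (?_ : (f R').val a * ((f R).val c - (f R).val a) = 0)).resolve_right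
      (sub_pos.2 hlt).ne'
    linarith
  have hb : (f R').val b = 0 := by
    refine (mul_eq_zero.1 (?_ : (f R').val b * ((f R).val c - (f R).val a) = 0)).resolve_right
      (sub_pos.2 hlt).ne'
    linarith
  have hc : (f R').val c = 0 := le_antisymm (hle.trans_eq ha) (hq0 c)
  have hzero : ∀ x, (f R').val x = 0 := fun x => by
    by_cases hxa : x = a
    · rwa [hxa]
    by_cases hxb : x = b
    · rwa [hxb]
    by_cases hxc : x = c
    · rwa [hxc]
    exact hq x hxa hxb hxc
  simpa [hzero] using (f R').property.2

end
end

section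
/- Let A = {w,x,y,z} be a set of four distinct alternatives, let p be a lottery on A with p(x) > 0 and p(y) > 0, let ε > 0 be small enough that q(x) ≥ 0 and q(y) ≥ 0, where q is the lottery with q(x) = p(x) − ε/(p(x)+p(z)), q(y) = p(y) − ε/(p(y)+p(z)), q(z) = p(z) + ε/(p(x)+p(z)) + ε/(p(y)+p(z)), and q(w) = p(w). Then for every preference relation ≻_i on A: (1) if z ≻_i x and z ≻_i y, then q ≻_i^PC p; (2) if x ≻_i z and y ≻_i z, then p ≻_i^PC q; (3) if x ≻_i z ≻_i y or y ≻_i z ≻_i x, then: (a) if p(w) = 0 or the rank of w in ≻_i is 1 or 4, then p ≿_i^PC q and q ≿_i^PC p; (b) if the rank of w in ≻_i is 2 and p(w) > 0, then p ≻_i^PC q; (c) if the rank of w in ≻_i is 3 and p(w) > 0, then q ≻_i^PC p. -/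
open scoped Classical
open Finset

noncomputable section

variable {A : Type*} [Fintype A]

/-- The rank of alternative `x` in the preference relation `r`:
`r(≻, x) = 1 + |{y ∈ A \ {x} : y ≻ x}|`. -/
def rank (r : Pref A) (x : A) : ℕ :=
  1 + (univ.filter fun y => y ≠ x ∧ r.val y x).card

/-- A sum over a type with exactly four elements. -/
lemma sum_univ_of_cover {A M : Type*} [Fintype A] [AddCommMonoid M] {w x y z : A}
    (hwx : w ≠ x) (hwy : w ≠ y) (hwz : w ≠ z)
    (hxy : x ≠ y) (hxz : x ≠ z) (hyz : y ≠ z)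
    (hcover : ∀ u : A, u = w ∨ u = x ∨ u = y ∨ u = z) (f : A → M) :
    ∑ u, f u = f w + (f x + (f y + f z)) := by
  have huniv : (univ : Finset A) = {w, x, y, z} := by
    ext u
    simpa using hcover u
  rw [huniv, sum_insert (by simp [*]), sum_insert (by simp [*]), sum_insert (by simp [*]),
    sum_singleton]

/-- The outcome of the comparison of `u` and `v`: `1` if `u ≻ v`, `-1` if `v ≻ u`, and `0` if
`u = v`. -/
def pcSign {A : Type*} (r : Pref A) (u v : A) : ℝ :=
  (if r.val u v then 1 else 0) - (if r.val v u then 1 else 0)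

lemma pcSign_of_rel {A : Type*} {r : Pref A} {u v : A} (h : r.val u v) : pcSign r u v = 1 := by
  have := r.property
  simp [pcSign, h, asymm_of r.val h]

lemma pcSign_of_rel_swap {A : Type*} {r : Pref A} {u v : A} (h : r.val v u) :
    pcSign r u v = -1 := by
  have := r.property
  simp [pcSign, h, asymm_of r.val h]

lemma pcSign_self {A : Type*} (r : Pref A) (u : A) : pcSign r u u = 0 := by
  simp [pcSign]

lemma pcSign_swap {A : Type*} (r : Pref A) (u v : A) : pcSign r u v = -pcSign r v u := by
  simp [pcSign]

lemma rel_or_rel_of_ne {A : Type*} (r : Pref A) {u v : A} (h : u ≠ v) :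
    r.val u v ∨ r.val v u := by
  have := r.property
  rcases trichotomous_of r.val u v with h' | h' | h'
  exacts [.inl h', absurd h' h, .inr h']

lemma neg_one_le_pcSign {A : Type*} (r : Pref A) (u v : A) : -1 ≤ pcSign r u v := by
  unfold pcSign
  split_ifs <;> norm_num

lemma pcSign_le_one {A : Type*} (r : Pref A) (u v : A) : pcSign r u v ≤ 1 := by
  unfold pcSign
  split_ifs <;> norm_num

/-- A better alternative performs at least as well against any third alternative. -/
lemma pcSign_le_of_rel {A : Type*} {r : Pref A} {u v t : A} (htu : t ≠ u) (h : r.val u v) :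
    pcSign r t u ≤ pcSign r t v := by
  have := r.property
  rcases rel_or_rel_of_ne r htu with h' | h'
  · rw [pcSign_of_rel h', pcSign_of_rel (trans_of r.val h' h)]
  · rw [pcSign_of_rel_swap h']
    exact neg_one_le_pcSign r t v

lemma PCsum_sub_PCsum_swap {A : Type*} [Fintype A] (r : Pref A) (p q : A → ℝ) :
    PCsum r p q - PCsum r q p = ∑ u, ∑ v, pcSign r u v * (p u * q v) := by
  unfold PCsum
  rw [sum_comm (f := fun u v => if r.val u v then q u * p v else 0), ← sum_sub_distrib]
  refine sum_congr rfl fun u _ => ?_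
  rw [← sum_sub_distrib]
  refine sum_congr rfl fun v _ => ?_
  unfold pcSign
  split_ifs <;> ring

/-- The PC-advantage of `p` over the lottery obtained from it by shifting probability `a` from `x`
to `z` and `b` from `y` to `z`. -/
lemma PCsum_sub_PCsum_swap_of_shift {A : Type*} [Fintype A] {w x y z : A}
    (hwx : w ≠ x) (hwy : w ≠ y) (hwz : w ≠ z)
    (hxy : x ≠ y) (hxz : x ≠ z) (hyz : y ≠ z)
    (hcover : ∀ u : A, u = w ∨ u = x ∨ u = y ∨ u = z) {p q : A → ℝ} {a b : ℝ}
    (hqx : q x = p x - a) (hqy : q y = p y - b) (hqz : q z = p z + a + b) (hqw : q w = p w)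
    (r : Pref A) :
    PCsum r p q - PCsum r q p =
      a * (p x + p z) * pcSign r x z + b * (p y + p z) * pcSign r y z
        + a * p y * (pcSign r y z - pcSign r y x) + b * p x * (pcSign r x z - pcSign r x y)
        + a * p w * (pcSign r w z - pcSign r w x) + b * p w * (pcSign r w z - pcSign r w y) := by
  rw [PCsum_sub_PCsum_swap]
  simp only [sum_univ_of_cover hwx hwy hwz hxy hxz hyz hcover, pcSign_self, hqx, hqy, hqz, hqw]
  rw [pcSign_swap r x w, pcSign_swap r y w, pcSign_swap r z w, pcSign_swap r y x,
    pcSign_swap r z x, pcSign_swap r z y]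
  ring

/-- The rank of `w` among four alternatives, one term for each of the others. -/
lemma rank_of_cover {A : Type*} [Fintype A] {w x y z : A}
    (hwx : w ≠ x) (hwy : w ≠ y) (hwz : w ≠ z)
    (hxy : x ≠ y) (hxz : x ≠ z) (hyz : y ≠ z)
    (hcover : ∀ u : A, u = w ∨ u = x ∨ u = y ∨ u = z) (r : Pref A) :
    rank r w = 1 + ((if r.val x w then 1 else 0) +
      ((if r.val y w then 1 else 0) + (if r.val z w then 1 else 0))) := by
  rw [rank, card_filter, sum_univ_of_cover hwx hwy hwz hxy hxz hyz hcover]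
  simp [hwx.symm, hwy.symm, hwz.symm]

/-- If `x ≻ z ≻ y`, the rank of `w` determines how `w` compares with `x`, `y` and `z`. -/
lemma pcSign_of_rank {A : Type*} [Fintype A] {w x y z : A}
    (hwx : w ≠ x) (hwy : w ≠ y) (hwz : w ≠ z)
    (hxy : x ≠ y) (hxz : x ≠ z) (hyz : y ≠ z)
    (hcover : ∀ u : A, u = w ∨ u = x ∨ u = y ∨ u = z) {r : Pref A}
    (hrxz : r.val x z) (hrzy : r.val z y) :
    (rank r w = 1 ∨ rank r w = 4 → pcSign r w x = pcSign r w z ∧ pcSign r w y = pcSign r w z) ∧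
    (rank r w = 2 → pcSign r w x = -1 ∧ pcSign r w z = 1 ∧ pcSign r w y = 1) ∧
    (rank r w = 3 → pcSign r w x = -1 ∧ pcSign r w z = -1 ∧ pcSign r w y = 1) := by
  have := r.property
  rw [rank_of_cover hwx hwy hwz hxy hxz hyz hcover r]
  rcases rel_or_rel_of_ne r hwx with hx | hx
  · have hz := trans_of r.val hx hrxz
    have hy := trans_of r.val hz hrzy
    simp [pcSign_of_rel, hx, hy, hz, asymm_of r.val hx, asymm_of r.val hy, asymm_of r.val hz]
  rcases rel_or_rel_of_ne r hwz with hz | hz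
  · have hy := trans_of r.val hz hrzy
    simp [pcSign_of_rel, pcSign_of_rel_swap, hx, hy, hz, asymm_of r.val hy, asymm_of r.val hz]
  rcases rel_or_rel_of_ne r hwy with hy | hy
  · simp [pcSign_of_rel, pcSign_of_rel_swap, hx, hy, hz, asymm_of r.val hy]
  · simp [pcSign_of_rel_swap, hx, hy, hz]

/-- The comparisons when `x ≻ z ≻ y`. -/
lemma pc_preferences_of_shift_to_middle {A : Type*} [Fintype A] {w x y z : A}
    (hwx : w ≠ x) (hwy : w ≠ y) (hwz : w ≠ z)
    (hxy : x ≠ y) (hxz : x ≠ z) (hyz : y ≠ z)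
    (hcover : ∀ u : A, u = w ∨ u = x ∨ u = y ∨ u = z) {p q : Lottery A} {a b : ℝ}
    (ha : 0 < a) (hb : 0 < b)
    (hab : a * (p.val x + p.val z) = b * (p.val y + p.val z))
    (hqx : q.val x = p.val x - a) (hqy : q.val y = p.val y - b)
    (hqz : q.val z = p.val z + a + b) (hqw : q.val w = p.val w)
    {r : Pref A} (hrxz : r.val x z) (hrzy : r.val z y) :
    ((p.val w = 0 ∨ rank r w = 1 ∨ rank r w = 4) → (PCge r p q ∧ PCge r q p)) ∧
    ((rank r w = 2 ∧ 0 < p.val w) → PCgt r p q) ∧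
    ((rank r w = 3 ∧ 0 < p.val w) → PCgt r q p) := by
  have := r.property
  have key := PCsum_sub_PCsum_swap_of_shift hwx hwy hwz hxy hxz hyz hcover hqx hqy hqz hqw r
  have hrxy := trans_of r.val hrxz hrzy
  rw [pcSign_of_rel hrxz, pcSign_of_rel hrxy, pcSign_of_rel_swap hrzy,
    pcSign_of_rel_swap hrxy, hab] at key
  obtain ⟨extreme, second, third⟩ :=
    pcSign_of_rank hwx hwy hwz hxy hxz hyz hcover hrxz hrzy
  unfold PCge PCgt
  refine ⟨?_, ?_, ?_⟩
  · rintro (hw | hw)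
    · rw [hw] at key
      constructor <;> linarith
    · rw [(extreme hw).1, (extreme hw).2] at key
      constructor <;> linarith
  · rintro ⟨hw, hpw⟩
    obtain ⟨h₁, h₂, h₃⟩ := second hw
    rw [h₁, h₂, h₃] at key
    linarith [mul_pos ha hpw]
  · rintro ⟨hw, hpw⟩
    obtain ⟨h₁, h₂, h₃⟩ := third hw
    rw [h₁, h₂, h₃] at key
    linarith [mul_pos hb hpw]

/-- Let `A = {w,x,y,z}` and let `q` be obtained from `p` by shifting
probability `ε/(p(x)+p(z))` from `x` to `z` and `ε/(p(y)+p(z))` from `y` to `z`.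
Then the stated PC-comparisons between `p` and `q` hold for every preference relation. -/
theorem pc_preferences_of_probability_shift
    {A : Type*} [Fintype A] (w x y z : A)
    (hwx : w ≠ x) (hwy : w ≠ y) (hwz : w ≠ z)
    (hxy : x ≠ y) (hxz : x ≠ z) (hyz : y ≠ z)
    (hcover : ∀ u : A, u = w ∨ u = x ∨ u = y ∨ u = z)
    (p q : Lottery A) (hpx : 0 < p.val x) (hpy : 0 < p.val y)
    (ε : ℝ) (hε : 0 < ε)
    (hqx : q.val x = p.val x - ε / (p.val x + p.val z))
    (hqy : q.val y = p.val y - ε / (p.val y + p.val z))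
    (hqz : q.val z = p.val z + ε / (p.val x + p.val z) + ε / (p.val y + p.val z))
    (hqw : q.val w = p.val w)
    (r : Pref A) :
    ((r.val z x ∧ r.val z y) → PCgt r q p) ∧
    ((r.val x z ∧ r.val y z) → PCgt r p q) ∧
    (((r.val x z ∧ r.val z y) ∨ (r.val y z ∧ r.val z x)) →
      ((p.val w = 0 ∨ rank r w = 1 ∨ rank r w = 4) → (PCge r p q ∧ PCge r q p)) ∧
      ((rank r w = 2 ∧ 0 < p.val w) → PCgt r p q) ∧
      ((rank r w = 3 ∧ 0 < p.val w) → PCgt r q p)) := by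
  have hpw : 0 ≤ p.val w := p.property.1 w
  have hpz : 0 ≤ p.val z := p.property.1 z
  have hxz_pos : 0 < p.val x + p.val z := by linarith
  have hyz_pos : 0 < p.val y + p.val z := by linarith
  have ha : 0 < ε / (p.val x + p.val z) := div_pos hε hxz_pos
  have hb : 0 < ε / (p.val y + p.val z) := div_pos hε hyz_pos
  have ha_mul : ε / (p.val x + p.val z) * (p.val x + p.val z) = ε :=
    div_mul_cancel₀ ε hxz_pos.ne'
  have hb_mul : ε / (p.val y + p.val z) * (p.val y + p.val z) = ε :=
    div_mul_cancel₀ ε hyz_pos.ne'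
  generalize ε / (p.val x + p.val z) = a at *
  generalize ε / (p.val y + p.val z) = b at *
  have key := PCsum_sub_PCsum_swap_of_shift hwx hwy hwz hxy hxz hyz hcover hqx hqy hqz hqw r
  rw [ha_mul, hb_mul] at key
  have hay := (mul_pos ha hpy).le
  have hbx := (mul_pos hb hpx).le
  have haw := mul_nonneg ha.le hpw
  have hbw := mul_nonneg hb.le hpw
  refine ⟨?_, ?_, ?_⟩
  · rintro ⟨hx, hy⟩
    rw [pcSign_of_rel_swap hx, pcSign_of_rel_swap hy] at key
    unfold PCgt
    linarith [mul_le_mul_of_nonneg_left (neg_one_le_pcSign r y x) hay,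
      mul_le_mul_of_nonneg_left (neg_one_le_pcSign r x y) hbx,
      mul_le_mul_of_nonneg_left (pcSign_le_of_rel hwz hx) haw,
      mul_le_mul_of_nonneg_left (pcSign_le_of_rel hwz hy) hbw]
  · rintro ⟨hx, hy⟩
    rw [pcSign_of_rel hx, pcSign_of_rel hy] at key
    unfold PCgt
    linarith [mul_le_mul_of_nonneg_left (pcSign_le_one r y x) hay,
      mul_le_mul_of_nonneg_left (pcSign_le_one r x y) hbx,
      mul_le_mul_of_nonneg_left (pcSign_le_of_rel hwx hx) haw,
      mul_le_mul_of_nonneg_left (pcSign_le_of_rel hwy hy) hbw]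
  · rintro (⟨h₁, h₂⟩ | ⟨h₁, h₂⟩)
    · exact pc_preferences_of_shift_to_middle hwx hwy hwz hxy hxz hyz hcover ha hb
        (ha_mul.trans hb_mul.symm) hqx hqy hqz hqw h₁ h₂
    · exact pc_preferences_of_shift_to_middle hwy hwx hwz hxy.symm hyz hxz
        (fun u => (hcover u).imp_right or_left_comm.mp) hb ha (hb_mul.trans ha_mul.symm)
        hqy hqx (hqz.trans (add_right_comm _ _ _)) hqw h₁ h₂

end
end

section
/- There exist a preference profile R and a lottery p such that p is not PC-efficient in R and no sequence of PC-improvements starting from p leads to a PC-efficient lottery. Concretely, let A = {a,b,c,d,e} and let R be the profile on eight voters with preferences: voter 1: b,d,c,a,e; voter 2: a,e,c,b,d; voter 3: d,c,a,b,e; voter 4: e,c,a,b,d; voter 5: b,d,e,c,a; voter 6: a,e,d,c,b; voter 7: b,e,d,c,a; voter 8: a,d,e,c,b; and let p be the lottery with p(a) = p(b) = 1/2. Then p is PC-dominated in R, and for every finite sequence of lotteries p = p_0, p_1, …, p_k in which p_{j+1} PC-dominates p_j in R for every j < k, the lottery p_k is not PC-efficient in R. -/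
open scoped Classical
open Finset

noncomputable section

variable {A : Type*} [Fintype A]

/-- `p` PC-dominates `q` in the profile `R`. -/
def PCDominates {I : Type*} (R : I → Pref A) (p q : Lottery A) : Prop :=
  (∀ i, PCge (R i) p q) ∧ (∃ i, PCgt (R i) p q)

/-- A lottery is PC-efficient in `R` if no lottery PC-dominates it. -/
def PCEfficientLottery {I : Type*} (R : I → Pref A) (p : Lottery A) : Prop :=
  ¬ ∃ q : Lottery A, PCDominates R q p

/-- A sum over a type exhausted by five distinct elements. -/
theorem sum_eq_of_five_cover {A : Type*} [Fintype A] {v w x y z : A}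
    (hvw : v ≠ w) (hvx : v ≠ x) (hvy : v ≠ y) (hvz : v ≠ z) (hwx : w ≠ x) (hwy : w ≠ y)
    (hwz : w ≠ z) (hxy : x ≠ y) (hxz : x ≠ z) (hyz : y ≠ z)
    (hcover : ∀ u : A, u = v ∨ u = w ∨ u = x ∨ u = y ∨ u = z) (f : A → ℝ) :
    ∑ u, f u = f v + f w + f x + f y + f z := by
  have huniv : (univ : Finset A) = {v, w, x, y, z} := by
    ext u
    simpa using hcover u
  rw [huniv, sum_insert, sum_insert, sum_insert, sum_insert, sum_singleton]
  · ring
  all_goals simp [*]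

/-- The pairwise comparison sum of a preference relation ranking `v, w, x, y, z` in this order. -/
theorem PCsum_eq_of_chain {A : Type*} [Fintype A] (r : Pref A) (v w x y z : A)
    (hcover : ∀ u : A, u = v ∨ u = w ∨ u = x ∨ u = y ∨ u = z)
    (hvw : r.val v w) (hwx : r.val w x) (hxy : r.val x y) (hyz : r.val y z) (p q : A → ℝ) :
    PCsum r p q = p v * (q w + q x + q y + q z) + p w * (q x + q y + q z)
      + p x * (q y + q z) + p y * q z := by
  obtain ⟨r, hr⟩ := r
  simp only at hvw hwx hxy hyz
  have irr : ∀ s, ¬ r s s := irrefl_of r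
  have tr : ∀ {s t u}, r s t → r t u → r s u := trans_of r
  have asymm : ∀ {s t}, r s t → ¬ r t s := fun h h' => irr _ (tr h h')
  have ne : ∀ {s t}, r s t → s ≠ t := fun h h' => irr _ (h' ▸ h)
  have hvx := tr hvw hwx
  have hvy := tr hvx hxy
  have hvz := tr hvy hyz
  have hwy := tr hwx hxy
  have hwz := tr hwy hyz
  have hxz := tr hxy hyz
  have hsum := sum_eq_of_five_cover (ne hvw) (ne hvx) (ne hvy) (ne hvz) (ne hwx) (ne hwy)
    (ne hwz) (ne hxy) (ne hxz) (ne hyz) hcover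
  simp only [PCsum, hsum, irr, hvw, hvx, hvy, hvz, hwx, hwy, hwz, hxy, hxz, hyz, asymm hvw,
    asymm hvx, asymm hvy, asymm hvz, asymm hwx, asymm hwy, asymm hwz, asymm hxy, asymm hxz,
    asymm hyz, if_true, if_false]
  ring

set_option maxHeartbeats 1000000 in
/-- In the given 8-voter profile over `A = {a,b,c,d,e}`, the lottery `p`
with `p(a) = p(b) = 1/2` is PC-dominated, yet no finite sequence of PC-improvements starting
from `p` ever reaches a PC-efficient lottery. -/
theorem no_path_of_pc_improvements_to_pc_efficiency
    {A : Type*} [Fintype A]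
    (a b c d e : A)
    (hab : a ≠ b) (hac : a ≠ c) (had : a ≠ d) (hae : a ≠ e)
    (hbc : b ≠ c) (hbd : b ≠ d) (hbe : b ≠ e)
    (hcd : c ≠ d) (hce : c ≠ e) (hde : d ≠ e)
    (hcover : ∀ u : A, u = a ∨ u = b ∨ u = c ∨ u = d ∨ u = e)
    (R : Fin 8 → Pref A)
    (h1 : (R 0).val b d ∧ (R 0).val d c ∧ (R 0).val c a ∧ (R 0).val a e)
    (h2 : (R 1).val a e ∧ (R 1).val e c ∧ (R 1).val c b ∧ (R 1).val b d)
    (h3 : (R 2).val d c ∧ (R 2).val c a ∧ (R 2).val a b ∧ (R 2).val b e)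
    (h4 : (R 3).val e c ∧ (R 3).val c a ∧ (R 3).val a b ∧ (R 3).val b d)
    (h5 : (R 4).val b d ∧ (R 4).val d e ∧ (R 4).val e c ∧ (R 4).val c a)
    (h6 : (R 5).val a e ∧ (R 5).val e d ∧ (R 5).val d c ∧ (R 5).val c b)
    (h7 : (R 6).val b e ∧ (R 6).val e d ∧ (R 6).val d c ∧ (R 6).val c a)
    (h8 : (R 7).val a d ∧ (R 7).val d e ∧ (R 7).val e c ∧ (R 7).val c b)
    (p : Lottery A) (hpa : p.val a = 1/2) (hpb : p.val b = 1/2) :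
    (∃ q : Lottery A, PCDominates R q p) ∧
    (∀ (k : ℕ) (seq : Fin (k + 1) → Lottery A),
      seq 0 = p →
      (∀ j : Fin k, PCDominates R (seq j.succ) (seq j.castSucc)) →
      ¬ PCEfficientLottery R (seq (Fin.last k))) := by
  have hsum := sum_eq_of_five_cover hab hac had hae hbc hbd hbe hcd hce hde hcover
  have e0 := PCsum_eq_of_chain (R 0) b d c a e (fun u => by have := hcover u; tauto)
    h1.1 h1.2.1 h1.2.2.1 h1.2.2.2
  have e1 := PCsum_eq_of_chain (R 1) a e c b d (fun u => by have := hcover u; tauto)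
    h2.1 h2.2.1 h2.2.2.1 h2.2.2.2
  have e2 := PCsum_eq_of_chain (R 2) d c a b e (fun u => by have := hcover u; tauto)
    h3.1 h3.2.1 h3.2.2.1 h3.2.2.2
  have e3 := PCsum_eq_of_chain (R 3) e c a b d (fun u => by have := hcover u; tauto)
    h4.1 h4.2.1 h4.2.2.1 h4.2.2.2
  have e4 := PCsum_eq_of_chain (R 4) b d e c a (fun u => by have := hcover u; tauto)
    h5.1 h5.2.1 h5.2.2.1 h5.2.2.2
  have e5 := PCsum_eq_of_chain (R 5) a e d c b (fun u => by have := hcover u; tauto)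
    h6.1 h6.2.1 h6.2.2.1 h6.2.2.2
  have e6 := PCsum_eq_of_chain (R 6) b e d c a (fun u => by have := hcover u; tauto)
    h7.1 h7.2.1 h7.2.2.1 h7.2.2.2
  have e7 := PCsum_eq_of_chain (R 7) a d e c b (fun u => by have := hcover u; tauto)
    h8.1 h8.2.1 h8.2.2.1 h8.2.2.2
  have exists_lottery : ∀ s t u : ℝ, 0 ≤ s → 0 ≤ t → 0 ≤ u → 2 * s + t + 2 * u = 1 →
      ∃ q : Lottery A, q.val a = s ∧ q.val b = s ∧ q.val c = t ∧ q.val d = u ∧ q.val e = u := by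
    intro s t u hs ht hu hstu
    refine ⟨⟨fun x => if x = a ∨ x = b then s else if x = c then t else u, ?_, ?_⟩, ?_⟩
    · intro x
      dsimp only
      split_ifs <;> assumption
    · rw [hsum]
      simp [hac.symm, hbc.symm, had.symm, hae.symm, hbd.symm, hbe.symm, hcd.symm, hce.symm]
      linarith
    · simp [hac.symm, hbc.symm, had.symm, hae.symm, hbd.symm, hbe.symm, hcd.symm, hce.symm]
  -- The three edges of the triangle spanned by `(a + b) / 2`, `c` and `(d + e) / 2`.
  let OnCycle : Lottery A → Prop := fun q =>
    q.val a = q.val b ∧ q.val d = q.val e ∧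
      ((0 < q.val a ∧ q.val d = 0) ∨ (0 < q.val c ∧ q.val a = 0) ∨ (0 < q.val d ∧ q.val c = 0))
  have dominated : ∀ q : Lottery A, OnCycle q → ∃ q', PCDominates R q' q := by
    rintro q ⟨hqab, hqde, ⟨hpos, hzero⟩ | ⟨hpos, hzero⟩ | ⟨hpos, hzero⟩⟩
    · obtain ⟨q', ha, hb, hc, hd, he⟩ := exists_lottery 0 1 0 (by norm_num) (by norm_num)
        (by norm_num) (by norm_num)
      refine ⟨q', fun i => ?_, 2, ?_⟩
      · fin_cases i <;> simp [PCge, e0, e1, e2, e3, e4, e5, e6, e7, ha, hb, hc, hd, he] <;> linarith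
      · simp [PCgt, e2, ha, hb, hc, hd, he]
        linarith
    · obtain ⟨q', ha, hb, hc, hd, he⟩ := exists_lottery 0 0 (1 / 2) (by norm_num) (by norm_num)
        (by norm_num) (by norm_num)
      refine ⟨q', fun i => ?_, 4, ?_⟩
      · fin_cases i <;> simp [PCge, e0, e1, e2, e3, e4, e5, e6, e7, ha, hb, hc, hd, he] <;> linarith
      · simp [PCgt, e4, ha, hb, hc, hd, he]
        linarith
    · obtain ⟨q', ha, hb, hc, hd, he⟩ := exists_lottery (1 / 2) 0 0 (by norm_num) (by norm_num)
        (by norm_num) (by norm_num)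
      refine ⟨q', fun i => ?_, 0, ?_⟩
      · fin_cases i <;> simp [PCge, e0, e1, e2, e3, e4, e5, e6, e7, ha, hb, hc, hd, he] <;> linarith
      · simp [PCgt, e0, ha, hb, hc, hd, he]
        linarith
  have closed : ∀ q q' : Lottery A, OnCycle q → PCDominates R q' q → OnCycle q' := by
    rintro ⟨q, hq, hq1⟩ ⟨q', hq', hq1'⟩ ⟨hqab, hqde, hcases⟩ ⟨hge, -⟩
    have g0 := hge 0
    have g1 := hge 1
    have g2 := hge 2
    have g3 := hge 3
    have g4 := hge 4
    have g5 := hge 5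
    have g6 := hge 6
    have g7 := hge 7
    rw [hsum] at hq1 hq1'
    simp only [PCge, e0, e1, e2, e3, e4, e5, e6, e7] at g0 g1 g2 g3 g4 g5 g6 g7
    simp only [OnCycle] at hqab hqde hcases ⊢
    have na := hq' a
    have nb := hq' b
    have nc := hq' c
    have nd := hq' d
    have ne := hq' e
    have mc := hq c
    have ma := hq a
    have md := hq d
    rw [← hqab, ← hqde] at g0 g1 g2 g3 g4 g5 g6 g7 hq1
    obtain ⟨hpos, hzero⟩ | ⟨hpos, hzero⟩ | ⟨hpos, hzero⟩ := hcases <;>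
      rw [hzero] at g0 g1 g2 g3 g4 g5 g6 g7 hq1
    · have hde0 : q' d + q' e ≤ 0 := le_of_mul_le_mul_left (by linarith) hpos
      have hd0 : q' d = 0 := by linarith
      have he0 : q' e = 0 := by linarith
      rw [hd0, he0] at g0 g1 g2 g3 g4 g5 g6 g7 hq1'
      have hpos' : 0 < q a + q c := by linarith
      have hle : q' a ≤ q' b := le_of_mul_le_mul_left (by linarith) hpos'
      have hge' : q' b ≤ q' a := le_of_mul_le_mul_left (by linarith) hpos'
      refine ⟨le_antisymm hle hge', by linarith, ?_⟩
      rcases na.lt_or_eq with h | h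
      · exact Or.inl ⟨h, hd0⟩
      · exact Or.inr (Or.inl ⟨by linarith, h.symm⟩)
    · have hab0 : q' a + q' b ≤ 0 := le_of_mul_le_mul_left (by linarith) hpos
      have ha0 : q' a = 0 := by linarith
      have hb0 : q' b = 0 := by linarith
      rw [ha0, hb0] at g0 g1 g2 g3 g4 g5 g6 g7 hq1'
      have hpos' : 0 < q d + q c := by linarith
      have hle : q' d ≤ q' e := le_of_mul_le_mul_left (by linarith) hpos'
      have hge' : q' e ≤ q' d := le_of_mul_le_mul_left (by linarith) hpos'
      refine ⟨by linarith, le_antisymm hle hge', ?_⟩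
      rcases nc.lt_or_eq with h | h
      · exact Or.inr (Or.inl ⟨h, ha0⟩)
      · exact Or.inr (Or.inr ⟨by linarith, h.symm⟩)
    · have hc0 : q' c = 0 := le_antisymm (le_of_mul_le_mul_left (by linarith) hpos) nc
      rw [hc0] at g0 g1 g2 g3 g4 g5 g6 g7 hq1'
      have hle : q' d ≤ q' e := le_of_mul_le_mul_left (by linarith) hpos
      have hge' : q' e ≤ q' d := le_of_mul_le_mul_left (by linarith) hpos
      have hde' : q' d = q' e := le_antisymm hle hge'
      rw [← hde'] at g0 g1 g2 g3 g4 g5 g6 g7 hq1'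
      have hpos' : 0 < q a + 2 * q d := by linarith
      have hle' : q' a ≤ q' b := le_of_mul_le_mul_left (by linarith) hpos'
      have hge'' : q' b ≤ q' a := le_of_mul_le_mul_left (by linarith) hpos'
      refine ⟨le_antisymm hle' hge'', hde', ?_⟩
      rcases nd.lt_or_eq with h | h
      · exact Or.inr (Or.inr ⟨h, hc0⟩)
      · exact Or.inl ⟨by linarith, h.symm⟩
  have start : OnCycle p := by
    have h := p.2.2
    rw [hsum] at h
    have hc := p.2.1 c
    have hd := p.2.1 d
    have he := p.2.1 e
    exact ⟨by linarith, by linarith, Or.inl ⟨by linarith, by linarith⟩⟩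
  refine ⟨dominated p start, fun k seq h0 hstep heff => heff (dominated _ ?_)⟩
  have onCycle : ∀ j : Fin (k + 1), OnCycle (seq j) := by
    intro j
    induction j using Fin.induction with
    | zero => exact h0 ▸ start
    | succ j ih => exact closed _ _ ih (hstep j)
  exact onCycle _

end
end

section
/- Let ≻_i and ≻_j be preference relations on a finite set A of alternatives and let p, q be lotteries on A with q ≿_i^PC p and q ≿_j^PC p. Then ∑_{x,y∈A: x ≻_i y and x ≻_j y} q(x)p(y) ≥ ∑_{x,y∈A: x ≻_i y and x ≻_j y} p(x)q(y). Moreover, if both sides of this inequality equal 0, then ∑_{x,y∈A: x ≻_i y and y ≻_j x} q(x)p(y) = ∑_{x,y∈A: x ≻_i y and y ≻_j x} p(x)q(y). -/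
open scoped Classical
open Finset

noncomputable section

variable {A : Type*} [Fintype A]

/-- The PC sum splits according to whether a second preference relation agrees. -/
theorem PCsum_eq_agree_add_disagree {A : Type*} [Fintype A] (r s : Pref A) (p q : A → ℝ) :
    PCsum r p q =
      (∑ x : A, ∑ y : A, if r.val x y ∧ s.val x y then p x * q y else 0) +
        ∑ x : A, ∑ y : A, if r.val x y ∧ s.val y x then p x * q y else 0 := by
  have := r.2
  have := s.2
  simp only [PCsum, ← sum_add_distrib]
  refine sum_congr rfl fun x _ => sum_congr rfl fun y _ => ?_
  by_cases hr : r.val x y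
  · rcases trichotomous_of s.val x y with h | rfl | h
    · simp [hr, h, asymm_of s.val h]
    · exact absurd hr (irrefl_of r.val x)
    · simp [hr, h, asymm_of s.val h]
  · simp [hr]

/-- Exchanging both the two preference relations and the two weight functions leaves the
disagreement sum unchanged. -/
theorem disagree_sum_swap {A : Type*} [Fintype A] (r s : Pref A) (p q : A → ℝ) :
    (∑ x : A, ∑ y : A, if s.val x y ∧ r.val y x then p x * q y else 0) =
      ∑ x : A, ∑ y : A, if r.val x y ∧ s.val y x then q x * p y else 0 := by
  rw [sum_comm]
  simp only [and_comm, mul_comm]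

/-- If two voters `i` and `j` both weakly PC-prefer `q` to `p`, then the
part of the PC-comparison on which both voters agree favors `q`; and if both such terms
vanish, then the parts on which the voters disagree are exactly balanced. -/
theorem pc_agreement_inequality
    {A : Type*} [Fintype A] (ri rj : Pref A) (p q : Lottery A)
    (hi : PCge ri q p) (hj : PCge rj q p) :
    ((∑ x : A, ∑ y : A, if ri.val x y ∧ rj.val x y then p.val x * q.val y else 0) ≤
      (∑ x : A, ∑ y : A, if ri.val x y ∧ rj.val x y then q.val x * p.val y else 0)) ∧
    (((∑ x : A, ∑ y : A, if ri.val x y ∧ rj.val x y then q.val x * p.val y else 0) = 0 ∧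
      (∑ x : A, ∑ y : A, if ri.val x y ∧ rj.val x y then p.val x * q.val y else 0) = 0) →
      (∑ x : A, ∑ y : A, if ri.val x y ∧ rj.val y x then q.val x * p.val y else 0) =
        (∑ x : A, ∑ y : A, if ri.val x y ∧ rj.val y x then p.val x * q.val y else 0)) := by
  unfold PCge at hi hj
  rw [PCsum_eq_agree_add_disagree ri rj, PCsum_eq_agree_add_disagree ri rj] at hi
  rw [PCsum_eq_agree_add_disagree rj ri, PCsum_eq_agree_add_disagree rj ri,
    disagree_sum_swap ri rj, disagree_sum_swap ri rj] at hj
  simp only [and_comm (a := rj.val _ _) (b := ri.val _ _)] at hj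
  refine ⟨by linarith, fun ⟨h, h'⟩ => by linarith⟩

end
end

section
/- For every preference profile R on a finite electorate N, every maximal lottery p ∈ ML(R) is PC-efficient in R. -/
open scoped Classical
open Finset

noncomputable section

variable {A : Type*} [Fintype A]

/-- Maximal lotteries: `p ∈ ML(R)` iff `∑_{x,y} p(x) q(y) g_R(x,y) ≥ 0` for all lotteries `q`. -/
def MaximalLottery {I : Type*} [Fintype I] (R : I → Pref A) (p : Lottery A) : Prop :=
  ∀ q : Lottery A, 0 ≤ ∑ x : A, ∑ y : A, p.val x * q.val y * ((margin R x y : ℤ) : ℝ)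

/-- The bilinear form of the majority margins is the sum over the voters of their
pairwise comparisons of the two lotteries. -/
lemma sum_mul_margin_eq_sum_PCsum_sub {I : Type*} [Fintype I] (R : I → Pref A) (p q : A → ℝ) :
    ∑ x : A, ∑ y : A, p x * q y * ((margin R x y : ℤ) : ℝ) =
      ∑ i : I, (PCsum (R i) p q - PCsum (R i) q p) := by
  have hswap (i : I) :
      PCsum (R i) q p = ∑ x : A, ∑ y : A, if (R i).val y x then p x * q y else 0 := by
    rw [PCsum, sum_comm]
    simp only [mul_comm]
  have hmargin (x y : A) : p x * q y * ((margin R x y : ℤ) : ℝ) =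
      ∑ i : I, ((if (R i).val x y then p x * q y else 0) -
        if (R i).val y x then p x * q y else 0) := by
    simp only [margin, sum_sub_distrib, ← sum_filter, sum_const, nsmul_eq_mul]
    push_cast
    ring
  simp only [hswap, hmargin]
  simp only [PCsum, ← sum_sub_distrib]
  rw [sum_comm (s := (univ : Finset I))]
  exact sum_congr rfl fun x _ => sum_comm

/-- Every maximal lottery is PC-efficient. -/
theorem maximal_lottery_pc_efficient
    {A N : Type*} [Fintype A] [Fintype N]
    (R : N → Pref A) (p : Lottery A) (hp : MaximalLottery R p) :
    PCEfficientLottery R p := by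
  rintro ⟨q, hge, i, hgt⟩
  have hnonneg := hp q
  rw [sum_mul_margin_eq_sum_PCsum_sub] at hnonneg
  have hneg : ∑ j : N, (PCsum (R j) p.val q.val - PCsum (R j) q.val p.val) < ∑ _j : N, (0 : ℝ) :=
    sum_lt_sum (fun j _ => sub_nonpos.mpr (hge j)) ⟨i, mem_univ i, sub_neg.mpr hgt⟩
  rw [sum_const_zero] at hneg
  exact hneg.not_ge hnonneg

end
end
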